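/- Suppose x : ℝ → ℝ^N is differentiable and satisfies x'(t) = −(Lᴵ + Lᴱ) x(t) for all t. Define y(t) = P⁻¹Uᵀx(t), e_x(t) = W x(t), and the inter-area variable e_y(t) = W_r y(t). Then e_y is differentiable and its derivative satisfies e_y'(t) = −W_r P⁻¹UᵀLᴱU e_y(t) − W_r P⁻¹UᵀLᴱ e_x(t) for all t. -/

import Mathlib

open Matrix

noncomputable section

/-- The node set of a network of `r` clusters with sizes `Nv α`. -/
abbrev ClusterNode (r : ℕ) (Nv : Fin r → ℕ) := (α : Fin r) × Fin (Nv α)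

/-- `U = diag(1_{N_1},…,1_{N_r}) ∈ ℝ^{N×r}`, the block-diagonal matrix whose
`α`-th column block is the all-ones vector `1_{N_α}`. -/
def clusterU (r : ℕ) (Nv : Fin r → ℕ) : Matrix (ClusterNode r Nv) (Fin r) ℝ :=
  Matrix.of fun v β => if v.1 = β then (1 : ℝ) else 0

/-- `P = diag(N_1,…,N_r) ∈ ℝ^{r×r}`. -/
def clusterP (r : ℕ) (Nv : Fin r → ℕ) : Matrix (Fin r) (Fin r) ℝ :=
  Matrix.diagonal fun α => (Nv α : ℝ)

/-- `P⁻¹ = diag(1/N_1,…,1/N_r) ∈ ℝ^{r×r}`. -/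
def clusterPinv (r : ℕ) (Nv : Fin r → ℕ) : Matrix (Fin r) (Fin r) ℝ :=
  Matrix.diagonal fun α => ((Nv α : ℝ))⁻¹

/-- The centering matrix `W_n = I_n − (1/n) 1_n 1_nᵀ`. -/
def centering (n : ℕ) : Matrix (Fin n) (Fin n) ℝ :=
  (1 : Matrix (Fin n) (Fin n) ℝ) - ((n : ℝ)⁻¹) • Matrix.of fun _ _ => (1 : ℝ)

/-- `W = diag(W_1,…,W_r)` the block-diagonal centering matrix. -/
def clusterW (r : ℕ) (Nv : Fin r → ℕ) : Matrix (ClusterNode r Nv) (ClusterNode r Nv) ℝ :=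
  Matrix.blockDiagonal' fun α => centering (Nv α)

/-- The slow variable `y = P⁻¹ Uᵀ x`. -/
def slowVar (r : ℕ) (Nv : Fin r → ℕ) (x : ClusterNode r Nv → ℝ) : Fin r → ℝ :=
  clusterPinv r Nv *ᵥ ((clusterU r Nv)ᵀ *ᵥ x)

/-- The fast variable `e_x = W x`. -/
def fastVar (r : ℕ) (Nv : Fin r → ℕ) (x : ClusterNode r Nv → ℝ) : ClusterNode r Nv → ℝ :=
  clusterW r Nv *ᵥ x

/-- The inter-area variable `e_y = W_r y`. -/
def interArea (r : ℕ) (Nv : Fin r → ℕ) (x : ClusterNode r Nv → ℝ) : Fin r → ℝ :=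
  centering r *ᵥ slowVar r Nv x

/-- `(U y)_v = y_{α}` for a node `v` of cluster `α`. -/
lemma clusterU_mulVec_apply {r : ℕ} {Nv : Fin r → ℕ} (y : Fin r → ℝ) (v : ClusterNode r Nv) :
    (clusterU r Nv *ᵥ y) v = y v.1 := by
  simp [clusterU, Matrix.mulVec, dotProduct]

/-- `Uᵀ` sums a vector over each cluster. -/
lemma clusterU_transpose_mulVec_apply {r : ℕ} {Nv : Fin r → ℕ} (z : ClusterNode r Nv → ℝ)
    (α : Fin r) : ((clusterU r Nv)ᵀ *ᵥ z) α = ∑ i, z ⟨α, i⟩ := by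
  simp only [clusterU, Matrix.mulVec, dotProduct, Matrix.transpose_apply, Matrix.of_apply,
    ite_mul, one_mul, zero_mul, Fintype.sum_sigma]
  rw [Finset.sum_eq_single α]
  · simp
  · intro β _ hβ
    simp [hβ]
  · simp

lemma centering_mulVec_apply {n : ℕ} (y : Fin n → ℝ) (i : Fin n) :
    (centering n *ᵥ y) i = y i - (n : ℝ)⁻¹ * ∑ j, y j := by
  rw [centering, Matrix.sub_mulVec, Matrix.smul_mulVec, Matrix.one_mulVec]
  simp [Matrix.mulVec, dotProduct]

lemma blockDiagonal'_mulVec_apply {r : ℕ} {Nv : Fin r → ℕ}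
    (M : ∀ α : Fin r, Matrix (Fin (Nv α)) (Fin (Nv α)) ℝ) (z : ClusterNode r Nv → ℝ)
    (α : Fin r) (i : Fin (Nv α)) :
    (Matrix.blockDiagonal' M *ᵥ z) ⟨α, i⟩ = (M α *ᵥ fun j => z ⟨α, j⟩) i := by
  simp only [Matrix.mulVec, dotProduct, Fintype.sum_sigma]
  rw [Finset.sum_eq_single α]
  · simp [Matrix.blockDiagonal'_apply_eq]
  · intro β _ hβ
    simp [Matrix.blockDiagonal'_apply_ne _ _ _ hβ.symm]
  · simp

/-- A vector splits into its deviation from the cluster means and the cluster means. -/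
lemma fastVar_add_clusterU_mulVec_slowVar {r : ℕ} {Nv : Fin r → ℕ} (z : ClusterNode r Nv → ℝ) :
    fastVar r Nv z + clusterU r Nv *ᵥ slowVar r Nv z = z := by
  ext ⟨α, i⟩
  rw [Pi.add_apply, fastVar, clusterW, blockDiagonal'_mulVec_apply, centering_mulVec_apply,
    clusterU_mulVec_apply, slowVar, clusterPinv, Matrix.mulVec_diagonal,
    clusterU_transpose_mulVec_apply, sub_add_cancel]

/-- `M U W_r = M U` for every matrix `M` annihilating the all-ones vector. -/
lemma mulVec_clusterU_mulVec_centering {r : ℕ} {Nv : Fin r → ℕ}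
    {M : Matrix (ClusterNode r Nv) (ClusterNode r Nv) ℝ} (hM : M *ᵥ (fun _ => (1 : ℝ)) = 0)
    (y : Fin r → ℝ) :
    M *ᵥ (clusterU r Nv *ᵥ (centering r *ᵥ y)) = M *ᵥ (clusterU r Nv *ᵥ y) := by
  have h : clusterU r Nv *ᵥ (centering r *ᵥ y) =
      clusterU r Nv *ᵥ y - ((r : ℝ)⁻¹ * ∑ j, y j) • fun _ => (1 : ℝ) := by
    ext v
    simp [clusterU_mulVec_apply, centering_mulVec_apply]
  rw [h, Matrix.mulVec_sub, Matrix.mulVec_smul, hM, smul_zero, sub_zero]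

/-- The internal Laplacian does not change the cluster sums. -/
lemma clusterU_transpose_mulVec_blockDiagonal' {r : ℕ} {Nv : Fin r → ℕ}
    {M : ∀ α : Fin r, Matrix (Fin (Nv α)) (Fin (Nv α)) ℝ} (hM : ∀ α, (M α).IsSymm)
    (hM1 : ∀ α, M α *ᵥ (fun _ => (1 : ℝ)) = 0) (z : ClusterNode r Nv → ℝ) :
    (clusterU r Nv)ᵀ *ᵥ (Matrix.blockDiagonal' M *ᵥ z) = 0 := by
  ext α
  have h : (fun _ => (1 : ℝ)) ᵥ* M α = 0 := by
    rw [← Matrix.mulVec_transpose, (hM α).eq, hM1]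
  have h' := Matrix.dotProduct_mulVec (fun _ => (1 : ℝ)) (M α) (fun j => z ⟨α, j⟩)
  rw [h, zero_dotProduct] at h'
  simpa [clusterU_transpose_mulVec_apply, blockDiagonal'_mulVec_apply, dotProduct] using h'

lemma HasDerivAt.const_mulVec {m n : Type*} [Fintype m] [Fintype n] (A : Matrix m n ℝ)
    {f : ℝ → n → ℝ} {f' : n → ℝ} {t : ℝ} (hf : HasDerivAt f f' t) :
    HasDerivAt (fun s => A *ᵥ f s) (A *ᵥ f') t :=
  (LinearMap.toContinuousLinearMap A.mulVecLin).hasFDerivAt.comp_hasDerivAt t hf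

/-- Lemma 2: along the consensus dynamics `x' = −(Lᴵ + Lᴱ)x`, the inter-area
variable `e_y = W_r y` is differentiable with
`e_y' = −W_r P⁻¹UᵀLᴱU e_y − W_r P⁻¹UᵀLᴱ e_x`. -/
theorem interArea_dynamics
    (r : ℕ) (Nv : Fin r → ℕ) (hNv : ∀ α, 0 < Nv α)
    (Lb : ∀ α : Fin r, Matrix (Fin (Nv α)) (Fin (Nv α)) ℝ)
    (hLb : ∀ α, (Lb α).PosSemidef)
    (hLb1 : ∀ α, Lb α *ᵥ (fun _ => (1 : ℝ)) = 0)
    (LE : Matrix (ClusterNode r Nv) (ClusterNode r Nv) ℝ)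
    (hLE : LE.PosSemidef)
    (hLE1 : LE *ᵥ (fun _ => (1 : ℝ)) = 0)
    (x : ℝ → ClusterNode r Nv → ℝ)
    (hx : ∀ t : ℝ, HasDerivAt x (-((Matrix.blockDiagonal' Lb + LE) *ᵥ x t)) t) :
    ∀ t : ℝ, HasDerivAt (fun s => interArea r Nv (x s))
      (-(centering r *ᵥ (clusterPinv r Nv *ᵥ ((clusterU r Nv)ᵀ *ᵥ
            (LE *ᵥ (clusterU r Nv *ᵥ interArea r Nv (x t))))))
        - centering r *ᵥ (clusterPinv r Nv *ᵥ
            ((clusterU r Nv)ᵀ *ᵥ (LE *ᵥ fastVar r Nv (x t))))) t := by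
  intro t
  have hderiv := (((hx t).const_mulVec (clusterU r Nv)ᵀ).const_mulVec
    (clusterPinv r Nv)).const_mulVec (centering r)
  refine hderiv.congr_deriv ?_
  have hsymm : ∀ α, (Lb α).IsSymm := fun α => by
    simpa [Matrix.IsHermitian, Matrix.IsSymm] using (hLb α).isHermitian
  have hLEx : LE *ᵥ x t = LE *ᵥ fastVar r Nv (x t) +
      LE *ᵥ (clusterU r Nv *ᵥ interArea r Nv (x t)) := by
    rw [interArea, mulVec_clusterU_mulVec_centering hLE1, ← Matrix.mulVec_add,
      fastVar_add_clusterU_mulVec_slowVar]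
  rw [Matrix.add_mulVec, hLEx]
  simp only [Matrix.mulVec_neg, Matrix.mulVec_add,
    clusterU_transpose_mulVec_blockDiagonal' hsymm hLb1, Matrix.mulVec_zero]
  abel
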